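/- Let g ≥ 3 be odd. Every ℤ-module automorphism f of M = ℤ^g/⟨2σ⟩ that preserves the mod-2 intersection form ⋆ and induces the identity automorphism of M/⟨σ̄⟩ is the identity automorphism of M. -/

import Mathlib

noncomputable section

open Submodule

/-- σ = e₁ + ⋯ + e_g ∈ ℤ^g, the sum of the standard basis vectors. -/
def sigmaVec (g : ℕ) : Fin g → ℤ := ∑ i, Pi.single i 1

/-- The submodule ⟨2σ⟩ of ℤ^g. -/
def relSub (g : ℕ) : Submodule ℤ (Fin g → ℤ) :=
  Submodule.span ℤ {(2 : ℤ) • sigmaVec g}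

/-- M = ℤ^g/⟨2σ⟩. -/
abbrev Mg (g : ℕ) := (Fin g → ℤ) ⧸ relSub g

/-- α_i ∈ M, the image of the standard basis vector e_i. -/
def alphaCl (g : ℕ) (i : Fin g) : Mg g := Submodule.Quotient.mk (Pi.single i 1)

/-- σ̄ = α₁ + ⋯ + α_g ∈ M. -/
def sigmaBar (g : ℕ) : Mg g := ∑ i, alphaCl g i

/-- Coordinatewise reduction ℤ^g → (ℤ/2ℤ)^g, as a ℤ-linear map. -/
def redHom (g : ℕ) : (Fin g → ℤ) →ₗ[ℤ] (Fin g → ZMod 2) :=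
  LinearMap.pi fun i => (Int.castAddHom (ZMod 2)).toIntLinearMap.comp (LinearMap.proj i)

lemma relSub_le_ker (g : ℕ) : relSub g ≤ LinearMap.ker (redHom g) := by
  rw [relSub, Submodule.span_le, Set.singleton_subset_iff]
  simp only [SetLike.mem_coe, LinearMap.mem_ker, map_smul]
  ext i
  simp [redHom]
  left
  decide

/-- The mod-2 reduction M → (ℤ/2ℤ)^g (well defined since 2σ reduces to 0). -/
def redQ (g : ℕ) : Mg g →ₗ[ℤ] (Fin g → ZMod 2) :=
  Submodule.liftQ (relSub g) (redHom g) (relSub_le_ker g)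

/-- The mod-2 intersection form ⋆ : M × M → ℤ/2ℤ, induced by the standard
inner product of ℤ^g reduced modulo 2. -/
def starForm (g : ℕ) (x y : Mg g) : ZMod 2 := ∑ i, redQ g x i * redQ g y i

/-- The projection M → M/⟨σ̄⟩. -/
def mkQs (g : ℕ) : Mg g →ₗ[ℤ] (Mg g ⧸ Submodule.span ℤ {sigmaBar g}) :=
  (Submodule.span ℤ {sigmaBar g}).mkQ

lemma redQ_sigmaBar (g : ℕ) (i : Fin g) : redQ g (sigmaBar g) i = 1 := by
  have h : ∀ j, redQ g (alphaCl g j) i = (Pi.single j (1 : ℤ) : Fin g → ℤ) i := fun j => rfl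
  simp [sigmaBar, map_sum, Finset.sum_apply, h, Pi.single_apply]

lemma two_smul_sigmaBar (g : ℕ) : (2 : ℤ) • sigmaBar g = 0 := by
  have h : sigmaBar g = (relSub g).mkQ (sigmaVec g) := by
    simp [sigmaBar, sigmaVec, alphaCl, map_sum]
  rw [h, ← map_smul, Submodule.mkQ_apply, Submodule.Quotient.mk_eq_zero]
  exact Submodule.mem_span_singleton_self _

/-- Adding `n • σ̄` to `x` changes `x ⋆ x` by `n * g`. -/
lemma starForm_add_zsmul_sigmaBar_self (g : ℕ) (x : Mg g) (n : ℤ) :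
    starForm g (x + n • sigmaBar g) (x + n • sigmaBar g) = starForm g x x + n * g := by
  have h : ∀ a b : ZMod 2, (a + b) * (a + b) = a * a + b := by decide
  simp [starForm, redQ_sigmaBar, h, Finset.sum_add_distrib, mul_comm]

/-- For odd g ≥ 3, every ℤ-module automorphism of M = ℤ^g/⟨2σ⟩ that preserves
the mod-2 intersection form ⋆ and induces the identity on M/⟨σ̄⟩ is the
identity automorphism of M. -/
theorem stmt5 (g : ℕ) (hg : 3 ≤ g) (hodd : Odd g)
    (f : Mg g ≃ₗ[ℤ] Mg g)
    (hstar : ∀ x y : Mg g, starForm g (f x) (f y) = starForm g x y)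
    (hq : ∀ x : Mg g, mkQs g (f x) = mkQs g x) :
    ∀ x : Mg g, f x = x := by
  intro x
  obtain ⟨n, hn⟩ := Submodule.mem_span_singleton.mp ((Submodule.Quotient.eq _).mp (hq x))
  have hf : f x = x + n • sigmaBar g := by rw [hn]; abel
  have hx := hstar x x
  rw [hf, starForm_add_zsmul_sigmaBar_self, ZMod.natCast_eq_one_iff_odd.mpr hodd, mul_one,
    add_eq_left] at hx
  obtain ⟨k, rfl⟩ := (ZMod.intCast_zmod_eq_zero_iff_dvd n 2).mp hx
  rw [hf, mul_comm, mul_smul, Nat.cast_ofNat, two_smul_sigmaBar, smul_zero, add_zero]
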